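/- Let C_cond and C_out be two NOR circuits, each with n inputs. Then there exist h ≥ n, β ≥ 1, α > 0, action functions S^i_t (for i ∈ {1,…,h} and t ∈ {1,…,β+1}) for an AS+FI market with h strategies, a price sequence P_0, …, P_β, and a function g : {0,1}^n → {0,1}^{h−n}, such that: (1) a 0-1 vector X = (X_1, …, X_h) is consistent with the price sequence P_0, …, P_β if and only if its first n coordinates r = (X_1, …, X_n) satisfy C_cond(r) = 1 and (X_{n+1}, …, X_h) = g(r) — so the consistent 0-1 assignments are in bijection with {r ∈ {0,1}^n : C_cond(r) = 1}; and (2) for every consistent 0-1 vector X with first n coordinates r, one has Σ_{i=1}^h X_i · S^i_{β+1}(P_0, …, P_β) > 0 if and only if C_out(r) = 1 (so under the fixed-increment rule, the price rises on day β+1 exactly when C_out(r) = 1). -/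

import Mathlib

/-- Wire values of a NOR circuit with `n` inputs and `m` NOR gates: wire `j < n`
is input `j`; wire `n + k` (for `k < m`) is the NOR of the two earlier wires
`(g k).1` and `(g k).2`; the circuit output is wire `n + m - 1` (the last gate). -/
def norWires (n m : ℕ) (g : (k : Fin m) → Fin (n + k.1) × Fin (n + k.1))
    (x : Fin n → Bool) : ℕ → Bool
  | j =>
    if hj : j < n then x ⟨j, hj⟩
    else if hk : j - n < m then
      have := (g ⟨j - n, hk⟩).1.isLt
      have := (g ⟨j - n, hk⟩).2.isLt
      !(norWires n m g x ((g ⟨j - n, hk⟩).1 : ℕ)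
        || norWires n m g x ((g ⟨j - n, hk⟩).2 : ℕ))
    else false
termination_by j => j
decreasing_by
  · omega
  · omega


/-- coefficient row: `+1` on `A`, `-1` on `B \ A`, `0` elsewhere. -/
def mktRow (A B : Finset ℕ) (i : ℕ) : ℤ :=
  if i ∈ A then 1 else if i ∈ B then -1 else 0

theorem mktRow_mem (A B : Finset ℕ) (i : ℕ) : mktRow A B i ∈ ({-1, 0, 1} : Set ℤ) := by
  unfold mktRow; split_ifs <;> simp

theorem mktRow_sum (h : ℕ) (Y : ℕ → ℤ) (A B : Finset ℕ) (hA : ∀ j ∈ A, j < h)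
    (hB : ∀ j ∈ B, j < h) (hAB : ∀ j ∈ A, j ∉ B) :
    ∑ i : Fin h, Y i.1 * mktRow A B i.1 = ∑ j ∈ A, Y j - ∑ j ∈ B, Y j := by
  rw [Fin.sum_univ_eq_sum_range (fun i => Y i * mktRow A B i) h]
  have e1 : ∑ j ∈ A, Y j = ∑ j ∈ Finset.range h, if j ∈ A then Y j else 0 := by
    rw [← Finset.sum_filter]
    congr 1; ext j; simp only [Finset.mem_filter, Finset.mem_range]
    exact ⟨fun q => ⟨hA j q, q⟩, fun q => q.2⟩
  have e2 : ∑ j ∈ B, Y j = ∑ j ∈ Finset.range h, if j ∈ B then Y j else 0 := by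
    rw [← Finset.sum_filter]
    congr 1; ext j; simp only [Finset.mem_filter, Finset.mem_range]
    exact ⟨fun q => ⟨hB j q, q⟩, fun q => q.2⟩
  rw [e1, e2, ← Finset.sum_sub_distrib]
  refine Finset.sum_congr rfl fun j _ => ?_
  unfold mktRow
  by_cases q : j ∈ A
  · simp [q, hAB j q]
  · by_cases q' : j ∈ B <;> simp [q, q']

/-- linear form of a NOR gate -/
def norGate (z a b : ℤ) : Prop := z + a < 2 ∧ z + b < 2 ∧ (0 < z ∨ 0 < a ∨ 0 < b)

theorem norWires_input (n m : ℕ) (g : (k : Fin m) → Fin (n + k.1) × Fin (n + k.1))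
    (x : Fin n → Bool) (j : ℕ) (hj : j < n) : norWires n m g x j = x ⟨j, hj⟩ := by
  rw [norWires]; simp [hj]

theorem norWires_gate (n m : ℕ) (g : (k : Fin m) → Fin (n + k.1) × Fin (n + k.1))
    (x : Fin n → Bool) (k : Fin m) : norWires n m g x (n + k.1) =
      !(norWires n m g x ((g k).1 : ℕ) || norWires n m g x ((g k).2 : ℕ)) := by
  rw [norWires]
  have h1 : ¬ (n + k.1 < n) := by omega
  have h2 : n + k.1 - n = k.1 := by omega
  have h3 : n + k.1 - n < m := by omega
  rw [dif_neg h1, dif_pos h3]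
  have h4 : (⟨n + k.1 - n, h3⟩ : Fin m) = k := Fin.ext h2
  have key : ∀ k' : Fin m, k' = k →
      (!(norWires n m g x ((g k').1 : ℕ) || norWires n m g x ((g k').2 : ℕ))) =
      !(norWires n m g x ((g k).1 : ℕ) || norWires n m g x ((g k).2 : ℕ)) := by
    rintro _ rfl; rfl
  exact key _ h4

theorem norGate_iff (n m : ℕ) (g : (k : Fin m) → Fin (n + k.1) × Fin (n + k.1))
    (x : Fin n → Bool) (W : ℕ → ℤ) (hW : ∀ j, W j = 0 ∨ W j = 1)
    (hx : ∀ j (hj : j < n), W j = if x ⟨j, hj⟩ then 1 else 0) :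
    (∀ k : Fin m, norGate (W (n + k.1)) (W (g k).1) (W (g k).2)) ↔
      ∀ k : Fin m, W (n + k.1) = if norWires n m g x (n + k.1) then 1 else 0 := by
  have aux : (∀ j, j < n + m → W j = if norWires n m g x j then 1 else 0) ↔
      ∀ k : Fin m, W (n + k.1) = if norWires n m g x (n + k.1) then 1 else 0 := by
    constructor
    · intro H k; exact H _ (by omega)
    · intro H j hj
      by_cases q : j < n
      · rw [norWires_input _ _ _ _ _ q]; exact hx j q
      · have := H ⟨j - n, by omega⟩
        have e : n + (j - n) = j := by omega
        simpa [e] using this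
  rw [← aux]
  constructor
  · intro H j
    induction j using Nat.strong_induction_on with
    | _ j ih =>
      intro hj
      by_cases q : j < n
      · rw [norWires_input _ _ _ _ _ q]; exact hx j q
      · obtain ⟨k, rfl⟩ : ∃ k : Fin m, j = n + k.1 := ⟨⟨j - n, by omega⟩, by simp; omega⟩
        have ha := ih (g k).1 (g k).1.isLt (by omega)
        have hb := ih (g k).2 (g k).2.isLt (by omega)
        obtain ⟨h1, h2, h3⟩ := H k
        rw [norWires_gate]
        have hz := hW (n + k.1)
        cases e1 : norWires n m g x ((g k).1 : ℕ) <;>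
          cases e2 : norWires n m g x ((g k).2 : ℕ) <;>
          simp [e1, e2] at ha hb ⊢ <;> omega
  · intro H k
    have ha := H (g k).1 (by omega)
    have hb := H (g k).2 (by omega)
    have hz := H (n + k.1) (by omega)
    rw [norWires_gate] at hz
    unfold norGate
    cases e1 : norWires n m g x ((g k).1 : ℕ) <;>
      cases e2 : norWires n m g x ((g k).2 : ℕ) <;>
      simp [e1, e2] at ha hb hz ⊢ <;> omega

/-- the three rows of a gate (with constant-one variables at `u` and `u+1`) -/
def gateRow (u z a b : ℕ) (c : Fin 3) : ℕ → ℤ :=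
  if c = 0 then mktRow {u, u + 1} {z, a}
  else if c = 1 then mktRow {u, u + 1} {z, b}
  else mktRow {z, a, b} ∅

theorem gateRow_mem (u z a b : ℕ) (c : Fin 3) (i : ℕ) :
    gateRow u z a b c i ∈ ({-1, 0, 1} : Set ℤ) := by
  unfold gateRow; split_ifs <;> exact mktRow_mem _ _ _

theorem gateRow_iff (h : ℕ) (Y : ℕ → ℤ) (hY : ∀ j, Y j = 0 ∨ Y j = 1) (u z a b : ℕ)
    (hu : Y u = 1) (hv : Y (u + 1) = 1) (h1 : u + 1 < h) (hz : z < h) (ha : a < h) (hb : b < h)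
    (zu : z ≠ u) (zv : z ≠ u + 1) (au : a ≠ u) (av : a ≠ u + 1) (bu : b ≠ u) (bv : b ≠ u + 1)
    (za : z ≠ a) (zb : z ≠ b) :
    (∀ c : Fin 3, 0 < ∑ i : Fin h, Y i.1 * gateRow u z a b c i.1) ↔
      norGate (Y z) (Y a) (Y b) := by
  have s0 : ∑ i : Fin h, Y i.1 * gateRow u z a b 0 i.1 = 2 - (Y z + Y a) := by
    simp only [gateRow, if_true]
    rw [mktRow_sum h Y, Finset.sum_pair (by omega), Finset.sum_pair za, hu, hv]
    · norm_num
    all_goals intro j hj; simp only [Finset.mem_insert, Finset.mem_singleton] at hj ⊢; omega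
  have s1 : ∑ i : Fin h, Y i.1 * gateRow u z a b 1 i.1 = 2 - (Y z + Y b) := by
    simp only [gateRow, if_true, if_neg (show ¬ ((1 : Fin 3) = 0) by decide)]
    rw [mktRow_sum h Y, Finset.sum_pair (by omega), Finset.sum_pair zb, hu, hv]
    · norm_num
    all_goals intro j hj; simp only [Finset.mem_insert, Finset.mem_singleton] at hj ⊢; omega
  have s2 : ∑ i : Fin h, Y i.1 * gateRow u z a b 2 i.1 = ∑ j ∈ ({z, a, b} : Finset ℕ), Y j := by
    simp only [gateRow, if_neg (show ¬ ((2 : Fin 3) = 0) by decide),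
      if_neg (show ¬ ((2 : Fin 3) = 1) by decide)]
    rw [mktRow_sum h Y]
    · simp
    · intro j hj; simp only [Finset.mem_insert, Finset.mem_singleton] at hj; omega
    · simp
    · simp
  have s3 : 0 < ∑ j ∈ ({z, a, b} : Finset ℕ), Y j ↔ (0 < Y z ∨ 0 < Y a ∨ 0 < Y b) := by
    rw [Finset.sum_pos_iff_of_nonneg (fun j _ => by have := hY j; omega)]
    simp
  rw [Fin.forall_fin_succ, Fin.forall_fin_succ, Fin.forall_fin_succ]
  change (0 < ∑ i : Fin h, Y i.1 * gateRow u z a b 0 i.1) ∧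
    (0 < ∑ i : Fin h, Y i.1 * gateRow u z a b 1 i.1) ∧
    (0 < ∑ i : Fin h, Y i.1 * gateRow u z a b 2 i.1) ∧ _ ↔ _
  rw [s0, s1, s2, s3]
  unfold norGate
  constructor
  · rintro ⟨q1, q2, q3, -⟩; exact ⟨by omega, by omega, q3⟩
  · rintro ⟨q1, q2, q3⟩; exact ⟨by omega, by omega, q3, fun i => i.elim0⟩

theorem single_sum (h : ℕ) (Y : ℕ → ℤ) (w : ℕ) (hw : w < h) :
    ∑ i : Fin h, Y i.1 * mktRow {w} ∅ i.1 = Y w := by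
  rw [mktRow_sum h Y] <;> simp [hw]

/-- variable carrying wire `j`; gate variables are shifted by `s` -/
def wpos (n s j : ℕ) : ℕ := if j < n then j else j + s

/-- Market built from a finite family of strict inequalities. -/
theorem market_of_rows (h : ℕ) {ι : Type} [Fintype ι] [Nonempty ι] (R : ι → ℕ → ℤ) (o : ℕ → ℤ)
    (hR : ∀ c i, R c i ∈ ({-1, 0, 1} : Set ℤ)) (ho : ∀ i, o i ∈ ({-1, 0, 1} : Set ℤ)) :
    ∃ (β : ℕ) (S : Fin h → (t : ℕ) → (Fin t → ℝ) → ℤ) (P : ℕ → ℝ), 1 ≤ β ∧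
      (∀ i t hist, S i t hist ∈ ({-1, 0, 1} : Set ℤ)) ∧
      (∀ X : Fin h → ℤ, (∀ t ∈ Finset.Icc 1 β,
            P t = P (t - 1)
              + (1 : ℝ) * ((∑ i, X i * S i t (fun j => P j.1)).sign : ℝ)) ↔
          ∀ c, 0 < ∑ i : Fin h, X i * R c i.1) ∧
      (∀ X : Fin h → ℤ, ∑ i, X i * S i (β + 1) (fun j => P j.1) = ∑ i : Fin h, X i * o i.1) := by
  let e := Fintype.equivFin ι
  refine ⟨Fintype.card ι, fun i t _ => if q : 1 ≤ t ∧ t ≤ Fintype.card ι then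
    R (e.symm ⟨t - 1, by omega⟩) i.1 else o i.1, fun t => (t : ℝ), Fintype.card_pos, ?_, ?_, ?_⟩
  · intro i t hist
    dsimp only
    split_ifs
    · exact hR _ _
    · exact ho _
  · intro X
    have key : ∀ (t : ℕ) (q : 1 ≤ t ∧ t ≤ Fintype.card ι) (s : ℤ),
        ((t : ℝ) = ((t - 1 : ℕ) : ℝ) + (1 : ℝ) * (s.sign : ℝ)) ↔ 0 < s := by
      intro t q s
      rw [Nat.cast_sub q.1, ← Int.sign_eq_one_iff_pos]
      constructor
      · intro H
        have : ((s.sign : ℤ) : ℝ) = ((1 : ℤ) : ℝ) := by push_cast at H ⊢; linarith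
        exact_mod_cast this
      · intro H; rw [H]; push_cast; ring
    constructor
    · intro H c
      have hc := (e c).isLt
      have q : 1 ≤ (e c).1 + 1 ∧ (e c).1 + 1 ≤ Fintype.card ι := by omega
      have := (key _ q _).1 (H ((e c).1 + 1) (Finset.mem_Icc.2 q))
      simp only [dif_pos q] at this
      simpa using this
    · intro H t ht
      have q := Finset.mem_Icc.1 ht
      refine (key t q _).2 ?_
      simp only [dif_pos q]
      exact H _
  · intro X
    simp

set_option maxHeartbeats 2000000

/-- circuits to an AS+FI market.
Given NOR circuits `C_cond` and `C_out`, each with `n` inputs (and `m₁ ≥ 1`,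
`m₂ ≥ 1` gates respectively), there exist `h ≥ n`, `β ≥ 1`, `α > 0`, action
functions `S i t` for an AS+FI market with `h` strategies, a price sequence
`P 0, …, P β`, and a map `g` from `{0,1}^n` to `{0,1}^{h-n}` (giving the last
`h - n` coordinates), such that: (1) a 0-1 vector `X` is consistent with the
price sequence iff its first `n` coordinates `r` satisfy `C_cond r = 1` and
its remaining coordinates equal `g r`; and (2) every consistent 0-1 vector `X`
with first coordinates `r` satisfies `∑ i, X i * S i (β+1) (P 0,…,P β) > 0`
iff `C_out r = 1`. -/
theorem stmt_14 (n m₁ m₂ : ℕ) (hm₁ : 1 ≤ m₁) (hm₂ : 1 ≤ m₂)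
    (gcond : (k : Fin m₁) → Fin (n + k.1) × Fin (n + k.1))
    (gout : (k : Fin m₂) → Fin (n + k.1) × Fin (n + k.1)) :
    ∃ (h β : ℕ) (hh : n ≤ h) (hβ : 1 ≤ β) (α : ℝ) (hα : 0 < α)
      (S : Fin h → (t : ℕ) → (Fin t → ℝ) → ℤ) (P : ℕ → ℝ)
      (g : (Fin n → ℤ) → Fin h → ℤ),
      (∀ i t hist, S i t hist ∈ ({-1, 0, 1} : Set ℤ)) ∧
      (∀ r : Fin n → ℤ, (∀ j, r j ∈ ({0, 1} : Set ℤ)) →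
        ∀ i, g r i ∈ ({0, 1} : Set ℤ)) ∧
      (∀ X : Fin h → ℤ, (∀ i, X i ∈ ({0, 1} : Set ℤ)) →
        ((∀ t ∈ Finset.Icc 1 β,
            P t = P (t - 1)
              + α * ((∑ i, X i * S i t (fun j => P j.1)).sign : ℝ)) ↔
          (norWires n m₁ gcond
              (fun j : Fin n => decide (X (Fin.castLE hh j) = 1))
              (n + m₁ - 1) = true ∧
           ∀ i : Fin h, n ≤ i.1 →
             X i = g (fun j : Fin n => X (Fin.castLE hh j)) i))) ∧
      (∀ X : Fin h → ℤ, (∀ i, X i ∈ ({0, 1} : Set ℤ)) →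
        (∀ t ∈ Finset.Icc 1 β,
          P t = P (t - 1)
            + α * ((∑ i, X i * S i t (fun j => P j.1)).sign : ℝ)) →
        ((0 < ∑ i, X i * S i (β + 1) (fun j => P j.1)) ↔
          norWires n m₂ gout
            (fun j : Fin n => decide (X (Fin.castLE hh j) = 1))
            (n + m₂ - 1) = true)) := by
  classical
  let H := n + 2 + m₁ + m₂
  let p₁ := wpos n 2
  let p₂ := wpos n (2 + m₁)
  let R : (Fin 2 ⊕ Unit) ⊕ (Fin m₁ × Fin 3) ⊕ (Fin m₂ × Fin 3) → ℕ → ℤ := fun c =>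
    match c with
    | Sum.inl (Sum.inl a) => mktRow {n + a.1} ∅
    | Sum.inl (Sum.inr _) => mktRow {p₁ (n + m₁ - 1)} ∅
    | Sum.inr (Sum.inl (k, c)) =>
        gateRow n (p₁ (n + k.1)) (p₁ (gcond k).1) (p₁ (gcond k).2) c
    | Sum.inr (Sum.inr (k, c)) =>
        gateRow n (p₂ (n + k.1)) (p₂ (gout k).1) (p₂ (gout k).2) c
  have hR : ∀ c i, R c i ∈ ({-1, 0, 1} : Set ℤ) := by
    rintro ((a | a) | (⟨k, c⟩ | ⟨k, c⟩)) i
    · exact mktRow_mem _ _ _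
    · exact mktRow_mem _ _ _
    · exact gateRow_mem _ _ _ _ _ _
    · exact gateRow_mem _ _ _ _ _ _
  obtain ⟨β, S, P, hβ, hS, hC, hO⟩ := market_of_rows H R (mktRow {p₂ (n + m₂ - 1)} ∅) hR
    (fun i => mktRow_mem _ _ i)
  have hh : n ≤ H := by omega
  let G : (Fin n → ℤ) → Fin H → ℤ := fun r i =>
    if i.1 < n + 2 then 1
    else if i.1 < n + 2 + m₁ then
      if norWires n m₁ gcond (fun j => decide (r j = 1)) (i.1 - 2) then 1 else 0
    else if norWires n m₂ gout (fun j => decide (r j = 1)) (i.1 - (2 + m₁)) then 1 else 0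
  have main : ∀ X : Fin H → ℤ, (∀ i, X i ∈ ({0, 1} : Set ℤ)) →
      ((∀ c, 0 < ∑ i : Fin H, X i * R c i.1) ↔
          (norWires n m₁ gcond
              (fun j : Fin n => decide (X (Fin.castLE hh j) = 1))
              (n + m₁ - 1) = true ∧
           ∀ i : Fin H, n ≤ i.1 →
             X i = G (fun j : Fin n => X (Fin.castLE hh j)) i)) := by
    intro X hX
    let Y : ℕ → ℤ := fun j => if q : j < H then X ⟨j, q⟩ else 0
    have YX : ∀ i : Fin H, X i = Y i.1 := fun i => by simp [Y]
    have hY : ∀ j, Y j = 0 ∨ Y j = 1 := by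
      intro j
      by_cases q : j < H
      · simpa [Y, q] using hX ⟨j, q⟩
      · simp [Y, q]
    have p₁n : ∀ k, p₁ (n + k) = n + k + 2 := fun k => by simp [p₁, wpos]
    have p₂n : ∀ k, p₂ (n + k) = n + k + (2 + m₁) := fun k => by simp [p₂, wpos]
    set x : Fin n → Bool := fun j : Fin n => decide (X (Fin.castLE hh j) = 1) with hxdef
    have hx : ∀ j (hj : j < n), Y j = if x ⟨j, hj⟩ then 1 else 0 := by
      intro j hj
      have e : X (Fin.castLE hh ⟨j, hj⟩) = Y j := YX _
      simp only [hxdef, e]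
      rcases hY j with q | q <;> simp [q]
    have g₁ := norGate_iff n m₁ gcond x (fun j => Y (p₁ j)) (fun j => hY _)
      (fun j hj => by simpa [p₁, wpos, hj] using hx j hj)
    have g₂ := norGate_iff n m₂ gout x (fun j => Y (p₂ j)) (fun j => hY _)
      (fun j hj => by simpa [p₂, wpos, hj] using hx j hj)
    have e₁ : n + m₁ - 1 = n + (m₁ - 1) := by omega
    -- constraints in terms of Y
    have step1 : (∀ c, 0 < ∑ i : Fin H, X i * R c i.1) ↔
        Y n = 1 ∧ Y (n + 1) = 1 ∧ Y (n + (m₁ - 1) + 2) = 1 ∧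
        (∀ k : Fin m₁, norGate (Y (p₁ (n + k.1))) (Y (p₁ (gcond k).1)) (Y (p₁ (gcond k).2))) ∧
        (∀ k : Fin m₂, norGate (Y (p₂ (n + k.1))) (Y (p₂ (gout k).1)) (Y (p₂ (gout k).2))) := by
      have pos1 : ∀ j, 0 < Y j ↔ Y j = 1 := fun j => by have := hY j; omega
      have a0 : (0 < ∑ i : Fin H, X i * R (Sum.inl (Sum.inl 0)) i.1) ↔ Y n = 1 := by
        simp only [YX, R]
        rw [single_sum H Y _ (by simp only [H]; simp; omega), pos1]; simp
      have a1 : (0 < ∑ i : Fin H, X i * R (Sum.inl (Sum.inl 1)) i.1) ↔ Y (n + 1) = 1 := by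
        simp only [YX, R]
        rw [single_sum H Y _ (by simp only [H]; simp; omega), pos1]; simp
      have a2 : (0 < ∑ i : Fin H, X i * R (Sum.inl (Sum.inr ())) i.1) ↔
          Y (n + (m₁ - 1) + 2) = 1 := by
        simp only [YX, R, e₁, p₁n]
        rw [single_sum H Y _ (by simp only [H]; omega), pos1]
      have a3 : Y n = 1 → Y (n + 1) = 1 → ∀ k : Fin m₁,
          ((∀ c, 0 < ∑ i : Fin H, X i * R (Sum.inr (Sum.inl (k, c))) i.1) ↔
          norGate (Y (p₁ (n + k.1))) (Y (p₁ (gcond k).1)) (Y (p₁ (gcond k).2))) := by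
        intro hu hv k
        simp only [YX, R]
        have := (gcond k).1.isLt
        have := (gcond k).2.isLt
        have := k.isLt
        apply gateRow_iff H Y hY n _ _ _ hu hv <;> simp only [p₁, wpos, H] <;> (try split_ifs) <;> omega
      have a4 : Y n = 1 → Y (n + 1) = 1 → ∀ k : Fin m₂,
          ((∀ c, 0 < ∑ i : Fin H, X i * R (Sum.inr (Sum.inr (k, c))) i.1) ↔
          norGate (Y (p₂ (n + k.1))) (Y (p₂ (gout k).1)) (Y (p₂ (gout k).2))) := by
        intro hu hv k
        simp only [YX, R]
        have := (gout k).1.isLt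
        have := (gout k).2.isLt
        have := k.isLt
        apply gateRow_iff H Y hY n _ _ _ hu hv <;> simp only [p₂, wpos, H] <;> (try split_ifs) <;> omega
      constructor
      · intro A
        have hu := a0.1 (A (Sum.inl (Sum.inl 0)))
        have hv := a1.1 (A (Sum.inl (Sum.inl 1)))
        exact ⟨hu, hv, a2.1 (A (Sum.inl (Sum.inr ()))), fun k => (a3 hu hv k).1 fun c => A (Sum.inr (Sum.inl (k, c))),
          fun k => (a4 hu hv k).1 fun c => A (Sum.inr (Sum.inr (k, c)))⟩
      · rintro ⟨hu, hv, hw, A, B⟩ ((a | a) | (⟨k, c⟩ | ⟨k, c⟩))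
        · fin_cases a
          · exact a0.2 hu
          · exact a1.2 hv
        · exact a2.2 hw
        · exact (a3 hu hv k).2 (A k) c
        · exact (a4 hu hv k).2 (B k) c
    rw [step1, g₁, g₂, e₁]
    simp only [p₁n, p₂n]
    constructor
    · rintro ⟨hu, hv, hw, A, B⟩
      constructor
      · have := A ⟨m₁ - 1, by omega⟩
        simp only [hw] at this
        by_contra q
        simp [q] at this
      · intro i hi
        have hiH : i.1 < n + 2 + m₁ + m₂ := i.isLt
        rw [YX i]
        simp only [G]
        split_ifs with q1 q2 q3 q3
        · rcases (show i.1 = n ∨ i.1 = n + 1 by omega) with q | q <;> rw [q] <;> assumption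
        all_goals first
          | (have z := A ⟨i.1 - 2 - n, by omega⟩
             have e : n + (i.1 - 2 - n) = i.1 - 2 := by omega
             have e' : i.1 - 2 + 2 = i.1 := by omega
             simp only [e, e'] at z
             rw [z]; simp [hxdef, q3]; done)
          | (have z := B ⟨i.1 - (2 + m₁) - n, by omega⟩
             have e : n + (i.1 - (2 + m₁) - n) = i.1 - (2 + m₁) := by omega
             have e' : i.1 - (2 + m₁) + (2 + m₁) = i.1 := by omega
             simp only [e, e'] at z
             rw [z]; simp [hxdef, q3]; done)
    · rintro ⟨hw, A⟩
      have A' : ∀ j (q : j < H), n ≤ j → Y j = G (fun j : Fin n => X (Fin.castLE hh j)) ⟨j, q⟩ := by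
        intro j q hj
        rw [← A ⟨j, q⟩ hj, YX]
      have C1 : ∀ k : Fin m₁, Y (n + k.1 + 2) =
          if norWires n m₁ gcond x (n + k.1) = true then 1 else 0 := by
        intro k
        have := k.isLt
        rw [A' _ (by simp only [H]; omega) (by omega)]
        simp only [G]
        rw [if_neg (by omega), if_pos (by omega)]
        rfl
      have C2 : ∀ k : Fin m₂, Y (n + k.1 + (2 + m₁)) =
          if norWires n m₂ gout x (n + k.1) = true then 1 else 0 := by
        intro k
        have := k.isLt
        rw [A' _ (by simp only [H]; omega) (by omega)]
        simp only [G]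
        rw [if_neg (by omega), if_neg (by omega), Nat.add_sub_cancel]
      refine ⟨?_, ?_, ?_, C1, C2⟩
      · rw [A' n (by simp only [H]; omega) (by omega)]; simp [G]
      · rw [A' (n + 1) (by simp only [H]; omega) (by omega)]; simp [G]
      · have := C1 ⟨m₁ - 1, by omega⟩
        simpa [hw] using this
  refine ⟨H, β, hh, hβ, 1, one_pos, S, P, G, hS, ?_, ?_, ?_⟩
  · intro r _ i
    simp only [G]
    split_ifs <;> simp
  · intro X hX
    rw [hC X]
    exact main X hX
  · intro X hX hcons
    obtain ⟨-, hg⟩ := (main X hX).1 ((hC X).1 hcons)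
    rw [hO X]
    have e₂ : p₂ (n + m₂ - 1) = n + m₂ - 1 + (2 + m₁) := by
      simp only [p₂, wpos]; rw [if_neg (by omega)]
    have hlt : n + m₂ - 1 + (2 + m₁) < H := by simp only [H]; omega
    have s := single_sum H (fun j => if q : j < H then X ⟨j, q⟩ else 0) _ hlt
    simp only [Fin.is_lt, dif_pos, Fin.eta, hlt] at s
    rw [e₂, s, hg _ (by simp; omega)]
    simp only [G]
    rw [if_neg (by omega), if_neg (by omega), Nat.add_sub_cancel]
    split_ifs with q <;> simp [q]
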